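/- Let F be a finite field and L an extension of F. Let A be a Sidon subspace of L of finite dimension dim(A) ≥ 3. Then dim(A²) > 2·dim(A) − 1. -/

import Mathlib

open Module Submodule

/-- Over a finite field the polynomial `X ^ 2 - X - m` has no root for a suitable `m`. -/
theorem exists_forall_sq_ne_add (F : Type*) [Field F] [Finite F] :
    ∃ m : F, ∀ r : F, r ^ 2 ≠ m + 1 * r := by
  have hns : ¬ Function.Surjective fun r : F => r ^ 2 - r := fun hs => by
    have h01 := Finite.injective_iff_surjective.2 hs (a₁ := 0) (a₂ := 1) (by simp)
    exact zero_ne_one h01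
  simp only [Function.Surjective, not_forall, not_exists] at hns
  obtain ⟨m, hm⟩ := hns
  exact ⟨m, fun r hr => hm r (by rw [hr]; ring)⟩

theorem one_add_four_mul_ne_zero {F : Type*} [Field F] {m : F}
    (hm : ∀ r : F, r ^ 2 ≠ m + 1 * r) : 1 + 4 * m ≠ 0 := by
  intro h
  have h2 : (2 : F) ≠ 0 := fun h2 => by
    have h4 : (4 : F) = 2 * 2 := by norm_num
    simp [h4, h2] at h
  refine hm (1 / 2) ?_
  field_simp
  linear_combination -h

theorem QuadraticAlgebra.norm_surjective_of_finite {F : Type*} [Field F] [Finite F] {m : F}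
    [Fact (∀ r : F, r ^ 2 ≠ m + 1 * r)] :
    Function.Surjective (QuadraticAlgebra.norm : QuadraticAlgebra F m 1 →* F) := by
  intro c
  have := Module.finite_of_finite F (M := QuadraticAlgebra F m 1)
  obtain ⟨z, hz⟩ := FiniteField.norm_surjective F (QuadraticAlgebra F m 1) c
  refine ⟨z, ?_⟩
  rw [← hz, ← QuadraticAlgebra.det_toLinearMap_eq_norm, Algebra.norm_apply]
  rfl

/-- The sum of an additive character of a field over the values of a linear form. -/
theorem AddChar.sum_linearMap {F V R : Type*} [Field F] [AddCommGroup V] [Module F V] [Fintype V]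
    [CommRing R] [IsDomain R] {χ : AddChar F R} (hχ : χ ≠ 1) (f : V →ₗ[F] F) [Decidable (f = 0)] :
    ∑ v, χ (f v) = if f = 0 then (Fintype.card V : R) else 0 := by
  split_ifs with hf
  · simp [hf]
  · obtain ⟨c, hc⟩ := AddChar.ne_one_iff.1 hχ
    obtain ⟨v, hv⟩ := LinearMap.surjective hf c
    have hne : χ.compAddMonoidHom f.toAddMonoidHom ≠ 1 :=
      AddChar.ne_one_iff.2 ⟨v, by simpa [hv] using hc⟩
    simpa using AddChar.sum_eq_zero_of_ne_one hne

section HermitianSum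

variable {F V : Type*} [Field F] [AddCommGroup V] [Module F V]

/-- The Hermitian form `(a, b) ↦ B a a + B a b - m B b b` attached to a symmetric bilinear form `B`
and the quadratic extension of `F` with norm form `x ^ 2 + x y - m y ^ 2`. -/
def hermForm (m : F) (B : V →ₗ[F] V →ₗ[F] F) (u : V × V) : F :=
  B u.1 u.1 + B u.1 u.2 - m * B u.2 u.2

/-- Multiplication by `ω`, where `ω ^ 2 = m + ω`, on pairs `(a, b)` regarded as `a + b ω`. -/
def omegaMul (m : F) (V : Type*) [AddCommGroup V] [Module F V] : Module.End F (V × V) :=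
  (m • LinearMap.snd F V V).prod (LinearMap.fst F V V + LinearMap.snd F V V)

theorem omegaMul_mul_omegaMul (m : F) :
    omegaMul m V * omegaMul m V = m • 1 + (1 : F) • omegaMul m V := by
  ext a <;> simp [omegaMul]

/-- The module of pairs `(a, b)` regarded as `a + b ω`, where `ω ^ 2 = m + ω`. -/
abbrev quadraticModule (m : F) (V : Type*) [AddCommGroup V] [Module F V] :
    Module (QuadraticAlgebra F m 1) (V × V) :=
  Module.compHom (V × V)
    (QuadraticAlgebra.lift ⟨omegaMul m V, omegaMul_mul_omegaMul m⟩ :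
      QuadraticAlgebra F m 1 →ₐ[F] Module.End F (V × V)).toRingHom

theorem hermForm_smul {m : F} {B : V →ₗ[F] V →ₗ[F] F} (hB : ∀ a b, B a b = B b a)
    (z : QuadraticAlgebra F m 1) (u : V × V) :
    hermForm m B (letI := quadraticModule m V; z • u) = z.norm * hermForm m B u := by
  have hz : (letI := quadraticModule m V; z • u) = z.re • u + z.im • omegaMul m V u := by
    change QuadraticAlgebra.lift ⟨omegaMul m V, omegaMul_mul_omegaMul m⟩ z u = _
    simp [QuadraticAlgebra.lift]
  rw [hz]
  simp only [omegaMul, hermForm, QuadraticAlgebra.norm_def, Prod.fst_add, Prod.snd_add,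
    Prod.smul_fst, Prod.smul_snd, LinearMap.prod_apply, Function.prod_apply, LinearMap.add_apply,
    LinearMap.smul_apply, LinearMap.fst_apply, LinearMap.snd_apply, map_add, map_smul,
    smul_eq_mul, hB u.2 u.1]
  ring

theorem card_sq_sub_one_dvd_card_hermForm_zeros [Finite F] [Finite V] {m : F}
    (hm : ∀ r : F, r ^ 2 ≠ m + 1 * r) {B : V →ₗ[F] V →ₗ[F] F} (hB : ∀ a b, B a b = B b a) :
    Nat.card F ^ 2 - 1 ∣ Nat.card {u : V × V // hermForm m B u = 0 ∧ u ≠ 0} := by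
  have : Fact (∀ r : F, r ^ 2 ≠ m + 1 * r) := ⟨hm⟩
  let := quadraticModule m V
  let X : SubMulAction (QuadraticAlgebra F m 1)ˣ (V × V) :=
    { carrier := {u | hermForm m B u = 0 ∧ u ≠ 0}
      smul_mem' := fun g u hu => ⟨by
        rw [Units.smul_def, hermForm_smul hB, hu.1, mul_zero], by
        rw [Units.smul_def, smul_ne_zero_iff]; exact ⟨g.ne_zero, hu.2⟩⟩ }
  have hfree (u : X) : MulAction.stabilizer (QuadraticAlgebra F m 1)ˣ u = ⊥ := by
    refine (Subgroup.eq_bot_iff_forall _).2 fun g hg => ?_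
    have hgu : (g : QuadraticAlgebra F m 1) • (u : V × V) = u :=
      congrArg Subtype.val (MulAction.mem_stabilizer_iff.1 hg)
    have h0 : ((g : QuadraticAlgebra F m 1) - 1) • (u : V × V) = 0 := by
      rw [sub_smul, hgu, one_smul, sub_self]
    exact Units.ext (sub_eq_zero.1 ((smul_eq_zero.1 h0).resolve_right u.2.2))
  have hX := Nat.card_congr (MulAction.selfEquivOrbitsQuotientProd hfree)
  rw [Nat.card_prod, Nat.card_units, Nat.card_congr (QuadraticAlgebra.equivProd m 1),
    Nat.card_prod, ← sq] at hX
  exact Dvd.intro_left _ hX.symm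

theorem sum_hermForm_const_smul [Finite F] [Fintype V] {R : Type*} [CommRing R]
    {χ : AddChar F R} {m : F} (hm : ∀ r : F, r ^ 2 ≠ m + 1 * r) {B : V →ₗ[F] V →ₗ[F] F}
    (hB : ∀ a b, B a b = B b a) {c : F} (hc : c ≠ 0) :
    ∑ u, χ (c * hermForm m B u) = ∑ u, χ (hermForm m B u) := by
  have : Fact (∀ r : F, r ^ 2 ≠ m + 1 * r) := ⟨hm⟩
  let := quadraticModule m V
  obtain ⟨z, rfl⟩ := QuadraticAlgebra.norm_surjective_of_finite (m := m) c
  have hz : z ≠ 0 := fun h => hc (by simp [h])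
  refine Fintype.sum_equiv (LinearEquiv.smulOfNeZero _ (V × V) z hz).toEquiv _ _ fun u => ?_
  rw [← hermForm_smul hB]
  rfl

theorem hermForm_add {m : F} {B : V →ₗ[F] V →ₗ[F] F} (hB : ∀ a b, B a b = B b a) (u w : V × V) :
    hermForm m B (u + w) = hermForm m B u + hermForm m B w +
      (B ((2 : F) • w.1 + w.2)).coprod (B (w.1 - (2 * m) • w.2)) u := by
  simp only [hermForm, Prod.fst_add, Prod.snd_add, map_add, map_sub, map_smul,
    LinearMap.add_apply, LinearMap.coprod_apply, LinearMap.sub_apply, LinearMap.smul_apply,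
    smul_eq_mul, hB w.1 u.1, hB w.2 u.1, hB w.2 u.2, hB w.1 u.2]
  ring

theorem coprod_polar_eq_zero_iff {m : F} (hm : ∀ r : F, r ^ 2 ≠ m + 1 * r)
    {B : V →ₗ[F] V →ₗ[F] F} (w : V × V) :
    (B ((2 : F) • w.1 + w.2)).coprod (B (w.1 - (2 * m) • w.2)) = 0 ↔
      w ∈ (LinearMap.ker B).prod (LinearMap.ker B) := by
  have key (x y : V →ₗ[F] F) : x.coprod y = 0 ↔ x = 0 ∧ y = 0 := by
    rw [LinearMap.ext_iff, LinearMap.ext_iff, LinearMap.ext_iff]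
    refine ⟨fun h => ⟨fun a => by simpa using h (a, 0), fun b => by simpa using h (0, b)⟩,
      fun h u => by simp [h.1 u.1, h.2 u.2]⟩
  simp only [key, map_add, map_sub, map_smul, Submodule.mem_prod, LinearMap.mem_ker]
  constructor
  · rintro ⟨h1, h2⟩
    have h3 : (1 + 4 * m) • B w.2 = 0 := by
      calc (1 + 4 * m) • B w.2
          = ((2 : F) • B w.1 + B w.2) - (2 : F) • (B w.1 - (2 * m) • B w.2) := by module
        _ = 0 := by rw [h1, h2]; simp
    have h4 := (smul_eq_zero.1 h3).resolve_left (one_add_four_mul_ne_zero hm)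
    exact ⟨by simpa [h4] using h2, h4⟩
  · rintro ⟨h1, h2⟩
    simp [h1, h2]

theorem sum_hermForm_sq [Fintype F] [Fintype V] {R : Type*} [CommRing R] [IsDomain R]
    {χ : AddChar F R} (hχ : χ ≠ 1) {m : F} (hm : ∀ r : F, r ^ 2 ≠ m + 1 * r)
    {B : V →ₗ[F] V →ₗ[F] F} (hB : ∀ a b, B a b = B b a) :
    (∑ u, χ (hermForm m B u)) ^ 2 =
      ((Fintype.card F : R) ^ (finrank F V + finrank F (LinearMap.ker B))) ^ 2 := by
  classical
  have hterm (w : V × V) : ∑ u, χ (hermForm m B (u + w)) * χ (-1 * hermForm m B u) =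
      if w ∈ (LinearMap.ker B).prod (LinearMap.ker B) then
        (Fintype.card (V × V) : R) else 0 := by
    have h1 (u : V × V) : χ (hermForm m B (u + w)) * χ (-1 * hermForm m B u) =
        χ (hermForm m B w) *
          χ ((B ((2 : F) • w.1 + w.2)).coprod (B (w.1 - (2 * m) • w.2)) u) := by
      rw [← AddChar.map_add_eq_mul, ← AddChar.map_add_eq_mul, hermForm_add hB]
      congr 1
      ring
    simp_rw [h1, ← Finset.mul_sum, AddChar.sum_linearMap hχ, coprod_polar_eq_zero_iff hm]
    split_ifs with hw
    · obtain ⟨hw1, hw2⟩ := hw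
      simp only [SetLike.mem_coe, LinearMap.mem_ker] at hw1 hw2
      simp [hermForm, hw1, hw2]
    · simp
  calc (∑ u, χ (hermForm m B u)) ^ 2
      = (∑ u, χ (-1 * hermForm m B u)) * ∑ w, χ (hermForm m B w) := by
        rw [sum_hermForm_const_smul hm hB (by simp), sq]
    _ = ∑ u, ∑ w, χ (hermForm m B (u + w)) * χ (-1 * hermForm m B u) := by
        rw [Finset.sum_mul]
        refine Finset.sum_congr rfl fun u _ => ?_
        rw [mul_comm, ← Finset.sum_mul]
        congr 1
        exact (Fintype.sum_equiv (Equiv.addLeft u) _ _ fun _ => rfl).symm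
    _ = (Fintype.card (V × V) : R) *
          Fintype.card ((LinearMap.ker B).prod (LinearMap.ker B)) := by
        rw [Finset.sum_comm]
        simp_rw [hterm]
        rw [← Finset.sum_filter, Finset.sum_const, nsmul_eq_mul, mul_comm,
          Fintype.card_subtype]
    _ = _ := by
        have := Module.Finite.of_finite (R := F) (M := V)
        rw [Fintype.card_prod, Fintype.card_congr (show ((LinearMap.ker B).prod (LinearMap.ker B) : Submodule F (V × V)) ≃
            LinearMap.ker B × LinearMap.ker B from Equiv.subtypeProdEquivProd),
          Fintype.card_prod, Module.card_eq_pow_finrank (K := F) (V := V),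
          Module.card_eq_pow_finrank (K := F) (V := LinearMap.ker B)]
        push_cast
        ring

/-- The Hermitian character sum has the same absolute value as the one over the hyperbolic form,
and its sign is given by the parity of the rank. -/
theorem sum_hermForm [Fintype F] [Fintype V] {R : Type*} [CommRing R] [IsDomain R] [CharZero R]
    {χ : AddChar F R} (hχ : χ ≠ 1) {m : F} (hm : ∀ r : F, r ^ 2 ≠ m + 1 * r)
    {B : V →ₗ[F] V →ₗ[F] F} (hB : ∀ a b, B a b = B b a) :
    ∑ u, χ (hermForm m B u) =
      (-(Fintype.card F : R)) ^ (finrank F V + finrank F (LinearMap.ker B)) := by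
  classical
  set e := finrank F V + finrank F (LinearMap.ker B)
  set q := Fintype.card F with hq
  set S := ∑ u, χ (hermForm m B u) with hS
  have hq2 : 2 ≤ q := Fintype.one_lt_card
  have hsq : S ^ 2 = ((-(q : R)) ^ e) ^ 2 := by
    rw [sum_hermForm_sq hχ hm hB, ← pow_mul, ← pow_mul, mul_comm e 2, pow_mul (-(q : R)),
      neg_sq, ← pow_mul]
  refine (sq_eq_sq_iff_eq_or_eq_neg.1 hsq).resolve_right fun hneg => ?_
  obtain ⟨M, hM⟩ := card_sq_sub_one_dvd_card_hermForm_zeros hm hB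
  have hzeros : Fintype.card {u : V × V // hermForm m B u = 0} = 1 + (q ^ 2 - 1) * M := by
    rw [Nat.card_eq_fintype_card, Nat.card_eq_fintype_card, Fintype.card_subtype] at hM
    rw [hq, ← hM, Fintype.card_subtype, ← Finset.filter_filter, Finset.filter_ne',
      add_comm, Finset.card_erase_add_one (Finset.mem_filter.2 ⟨Finset.mem_univ _, by simp [hermForm]⟩)]
  have hsum : ((q : R) - 1) * S =
      q * (Fintype.card {u : V × V // hermForm m B u = 0} : R) - q ^ (2 * finrank F V) := by
    have h1 : ∑ c : F, ∑ u, χ (c * hermForm m B u) = q ^ (2 * finrank F V) + (q - 1) * S := by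
      rw [← Finset.add_sum_erase _ _ (Finset.mem_univ (0 : F)),
        Finset.sum_congr rfl fun c hc => sum_hermForm_const_smul hm hB (Finset.ne_of_mem_erase hc),
        Finset.sum_const, Finset.card_erase_of_mem (Finset.mem_univ _), Finset.card_univ,
        nsmul_eq_mul, Nat.cast_sub (by omega), Nat.cast_one]
      simp [Module.card_eq_pow_finrank (K := F) (V := V), ← hq, two_mul, pow_add, ← hS]
    have h2 : ∑ c : F, ∑ u, χ (c * hermForm m B u) =
        q * (Fintype.card {u : V × V // hermForm m B u = 0} : R) := by
      rw [Finset.sum_comm]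
      simp_rw [AddChar.sum_mulShift _ (AddChar.IsPrimitive.of_ne_one hχ)]
      push_cast
      rw [← Finset.sum_filter, Finset.sum_const, nsmul_eq_mul, mul_comm, Fintype.card_subtype]
    linear_combination h2 - h1
  have hint : ((q : ℤ) - 1) * (-(-(q : ℤ)) ^ e) =
      q * (1 + (q ^ 2 - 1) * M) - q ^ (2 * finrank F V) := by
    rw [hneg, hzeros] at hsum
    have h1 : 1 ≤ q ^ 2 := Nat.one_le_pow _ _ (by omega)
    push_cast [Nat.cast_sub h1] at hsum
    exact (Int.cast_injective (α := R)) (by push_cast; exact hsum)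
  obtain ⟨s, hs⟩ := sub_dvd_pow_sub_pow (-(q : ℤ)) 1 e
  obtain ⟨t, ht⟩ := sub_dvd_pow_sub_pow ((q : ℤ) ^ 2) 1 (finrank F V)
  rw [one_pow] at hs ht
  rw [← pow_mul] at ht
  have hdvd : ((q : ℤ) + 1) ∣ 2 := by
    refine ⟨s - (q * M - t), mul_left_cancel₀ (a := (q : ℤ) - 1) (by omega) ?_⟩
    linear_combination (-1 : ℤ) * hint + ht - (q - 1 : ℤ) * hs
  have := Int.le_of_dvd (by norm_num) hdvd
  omega

theorem sum_bilin [Fintype F] [Fintype V] {R : Type*} [CommRing R] [IsDomain R]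
    {χ : AddChar F R} (hχ : χ ≠ 1) (B : V →ₗ[F] V →ₗ[F] F) :
    ∑ a, ∑ b, χ (B a b) =
      (Fintype.card F : R) ^ (finrank F V + finrank F (LinearMap.ker B)) := by
  classical
  simp_rw [AddChar.sum_linearMap hχ]
  rw [← Finset.sum_filter, Finset.sum_const, nsmul_eq_mul, mul_comm, pow_add, ← Nat.cast_pow,
    ← Nat.cast_pow, ← Module.card_eq_pow_finrank, ← Module.card_eq_pow_finrank,
    ← Fintype.card_subtype]
  congr 2
  exact Fintype.card_congr (Equiv.refl _)

theorem sum_dual [Fintype F] {W : Type*} [AddCommGroup W] [Module F W] [Module.Finite F W]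
    [Fintype (Dual F W)] {R : Type*} [CommRing R] [IsDomain R] {χ : AddChar F R} (hχ : χ ≠ 1)
    (w : W) [Decidable (w = 0)] :
    ∑ φ : Dual F W, χ (φ w) = if w = 0 then (Fintype.card F : R) ^ finrank F W else 0 := by
  classical
  have h := AddChar.sum_linearMap hχ (Dual.eval F W w)
  rw [Module.card_eq_pow_finrank (K := F), Subspace.dual_finrank_eq] at h
  simp only [Dual.eval_apply, eval_apply_eq_zero_iff, Nat.cast_pow] at h
  exact h

end HermitianSum

/-- The two counts of zeros are incompatible when the product space has dimension `2 k - 1`. -/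
theorem ne_of_counting_identities {q E D : ℤ} {k n : ℕ} (hq : 2 ≤ q) (hk : 3 ≤ k)
    (hn : n + 1 = 2 * k) (hcount : q ^ n = 1 + E + D)
    (hsum : q ^ (k + k) + E * q ^ (k + 0) + D * q ^ (k + 1) = q ^ n * (2 * q ^ k - 1)) :
    (-q) ^ (k + k) + E * (-q) ^ (k + 0) + D * (-q) ^ (k + 1) ≠ q ^ n := by
  intro hsum_neg
  have hQ : q ^ 2 < q ^ k := pow_lt_pow_right₀ (by omega) (by omega)
  have hw : q * q ^ n = q ^ k * q ^ k := by rw [← pow_succ', hn, two_mul, pow_add]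
  simp only [pow_add, pow_zero, pow_one, mul_one] at hsum hsum_neg
  generalize q ^ n = w at *
  have hQ0 : q ^ k ≠ 0 := by positivity
  have h2Q : 2 * q ^ k ≠ 0 := mul_ne_zero two_ne_zero hQ0
  rcases Nat.even_or_odd k with he | ho
  · rw [he.neg_pow] at hsum_neg
    generalize q ^ k = Q at *
    have hE : Q + E = w := mul_left_cancel₀ h2Q (by linear_combination hsum + hsum_neg)
    have : (Q * (Q - 1)) * (Q - q ^ 2) = 0 := by
      obtain rfl : D = Q - 1 := by linarith
      obtain rfl : E = w - Q := by linarith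
      linear_combination q * hsum_neg - (Q - 1) * hw
    have h1 : Q - 1 ≠ 0 := by nlinarith
    exact (mul_ne_zero (mul_ne_zero hQ0 h1) (by linarith)) this
  · rw [ho.neg_pow] at hsum_neg
    generalize q ^ k = Q at *
    have hD : Q + q * D = w := mul_left_cancel₀ h2Q (by linear_combination hsum + hsum_neg)
    have hE : q * E = (Q - 1) * Q := mul_left_cancel₀ h2Q (by
      linear_combination q * (hsum - hsum_neg) + 2 * (Q - 1) * hw)
    have : (Q - q) ^ 2 = 0 := by
      linear_combination (q - 1) * hw - q ^ 2 * hcount - q * hE - q * hD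
    have h1 := pow_eq_zero_iff (two_ne_zero) |>.1 this
    nlinarith

section Sidon

variable {F L : Type*} [Field F] [Field L] [Algebra F L]

/-- The symmetric bilinear form `(a, b) ↦ φ (a b)` on `A`. -/
noncomputable def productForm (A : Submodule F L) (φ : Dual F ↥(A * A)) : A →ₗ[F] A →ₗ[F] F :=
  LinearMap.compr₂ (TensorProduct.mk F A A) (φ ∘ₗ Submodule.mulMap' A A)

theorem productForm_apply (A : Submodule F L) (φ : Dual F ↥(A * A)) (a b : A) :
    productForm A φ a b = φ ⟨a * b, Submodule.mul_mem_mul a.2 b.2⟩ :=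
  congrArg φ (Subtype.ext (Submodule.val_mulMap'_tmul ..))

theorem productForm_comm (A : Submodule F L) (φ : Dual F ↥(A * A)) (a b : A) :
    productForm A φ a b = productForm A φ b a := by
  simp only [productForm_apply, mul_comm]

theorem finrank_map_mulLeft (A : Submodule F L) {a : L} (ha : a ≠ 0) :
    finrank F (A.map (LinearMap.mulLeft F a)) = finrank F A :=
  (Submodule.equivMapOfInjective _ (mul_right_injective₀ ha) A).finrank_eq.symm

theorem map_mulLeft_sup_le {A : Submodule F L} {a b : L} (ha : a ∈ A) (hb : b ∈ A) :
    A.map (LinearMap.mulLeft F a) ⊔ A.map (LinearMap.mulLeft F b) ≤ A * A := by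
  refine sup_le ?_ ?_ <;> rintro _ ⟨c, hc, rfl⟩
  exacts [Submodule.mul_mem_mul ha hc, Submodule.mul_mem_mul hb hc]

/-- A subspace meets its dilates by elements outside the base field in dimension at most one. -/
def IsSidonSpace (A : Submodule F L) : Prop :=
  ∀ x : L, x ∉ Set.range (algebraMap F L) →
    finrank F ↥(A ⊓ A.map (LinearMap.mulLeft F x)) ≤ 1

variable {A : Submodule F L} [FiniteDimensional F A]

theorem IsSidonSpace.two_mul_finrank_le (hA : IsSidonSpace A) {a b : L}
    (hab : LinearIndependent F ![a, b]) :
    2 * finrank F A ≤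
      finrank F ↥(A.map (LinearMap.mulLeft F a) ⊔ A.map (LinearMap.mulLeft F b)) + 1 := by
  have ha : a ≠ 0 := hab.ne_zero 0
  have hb : b ≠ 0 := hab.ne_zero 1
  have hx : b / a ∉ Set.range (algebraMap F L) := by
    rintro ⟨c, hc⟩
    have := (LinearIndependent.pair_iff.1 hab) c (-1) (by
      rw [Algebra.smul_def, hc]; field_simp; simp)
    simp at this
  have hinf : A.map (LinearMap.mulLeft F a) ⊓ A.map (LinearMap.mulLeft F b) =
      (A ⊓ A.map (LinearMap.mulLeft F (b / a))).map (LinearMap.mulLeft F a) := by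
    rw [Submodule.map_inf _ (mul_right_injective₀ ha), ← Submodule.map_comp,
      ← LinearMap.mulLeft_mul, mul_div_cancel₀ _ ha]
  have h := Submodule.finrank_sup_add_finrank_inf_eq
    (A.map (LinearMap.mulLeft F a)) (A.map (LinearMap.mulLeft F b))
  rw [hinf, finrank_map_mulLeft _ ha, finrank_map_mulLeft _ ha, finrank_map_mulLeft _ hb] at h
  have := hA _ hx
  omega

theorem IsSidonSpace.finrank_ker_productForm_le (hA : IsSidonSpace A)
    (hdim : finrank F ↥(A * A) + 1 ≤ 2 * finrank F A) {φ : Dual F ↥(A * A)} (hφ : φ ≠ 0) :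
    finrank F (LinearMap.ker (productForm A φ)) ≤ 1 := by
  have : FiniteDimensional F ↥(A * A) := Module.Finite.iff_fg.2
    ((Module.Finite.iff_fg.1 ‹_›).mul (Module.Finite.iff_fg.1 ‹_›))
  by_contra! hlt
  have : Nontrivial (LinearMap.ker (productForm A φ)) :=
    Module.nontrivial_of_finrank_pos (R := F) (by omega)
  obtain ⟨x, hx⟩ := exists_ne (0 : LinearMap.ker (productForm A φ))
  obtain ⟨y, hxy⟩ := exists_linearIndependent_pair_of_one_lt_finrank (R := F)
    (M := LinearMap.ker (productForm A φ)) hlt hx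
  have hli : LinearIndependent F ![(x : L), (y : L)] := by
    refine LinearIndependent.pair_iff.2 fun s t hst => ?_
    exact (LinearIndependent.pair_iff (R := F) (M := LinearMap.ker (productForm A φ))).1 hxy s t
      (Subtype.ext (Subtype.ext hst))
  have heq := Submodule.eq_of_le_of_finrank_le (map_mulLeft_sup_le x.1.2 y.1.2)
    (by have := hA.two_mul_finrank_le hli; omega)
  have hvanish : A * A ≤ (LinearMap.ker φ).map (A * A).subtype := by
    conv_lhs => rw [← heq]
    have key (z : LinearMap.ker (productForm A φ)) :
        A.map (LinearMap.mulLeft F (z : L)) ≤ (LinearMap.ker φ).map (A * A).subtype := by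
      rintro _ ⟨c, hc, rfl⟩
      refine ⟨⟨z * c, Submodule.mul_mem_mul z.1.2 hc⟩, ?_, rfl⟩
      have := LinearMap.congr_fun (LinearMap.mem_ker.1 z.2) ⟨c, hc⟩
      rwa [productForm_apply] at this
    exact sup_le (key x) (key y)
  refine hφ (LinearMap.ext fun w => ?_)
  obtain ⟨w', hw', hww'⟩ := hvanish w.2
  rw [← Subtype.ext hww']
  exact hw'

theorem IsSidonSpace.eq_zero_of_norm_eq_zero (hA : IsSidonSpace A) {m : F}
    (hm : ∀ r : F, r ^ 2 ≠ m + 1 * r) {a b : L} (ha : a ∈ A) (hb : b ∈ A)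
    (h : a * a + a * b - m • (b * b) = 0) : a = 0 ∧ b = 0 := by
  by_cases hb0 : b = 0
  · subst hb0
    simpa using h
  exfalso
  rw [Algebra.smul_def] at h
  set μ := algebraMap F L m with hμ
  have hm0 : m ≠ 0 := fun h0 => hm 0 (by simp [h0])
  have hx : -(a / b) ∉ Set.range (algebraMap F L) := by
    rintro ⟨c, hc⟩
    refine hm c ((algebraMap F L).injective ?_)
    simp only [map_pow, map_add, map_mul, map_one, hc, ← hμ]
    field_simp
    linear_combination h
  have hli : LinearIndependent F ![a, b] := by
    refine LinearIndependent.pair_iff.2 fun s t hst => ?_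
    rw [Algebra.smul_def, Algebra.smul_def] at hst
    have hs : s = 0 := by
      by_contra hs
      have hs' : algebraMap F L s ≠ 0 := by simpa using hs
      refine hx ⟨t / s, ?_⟩
      rw [map_div₀]
      field_simp
      linear_combination hst
    subst hs
    simpa [hb0] using hst
  have hmem : ∀ i, ![a, μ * b - a] i ∈ A ⊓ A.map (LinearMap.mulLeft F (-(a / b))) := by
    have hμb : μ * b ∈ A := by rw [hμ, ← Algebra.smul_def]; exact A.smul_mem _ hb
    intro i
    fin_cases i
    · exact ⟨ha, -b, A.neg_mem hb, by simp; field_simp⟩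
    · refine ⟨A.sub_mem hμb ha, -a, A.neg_mem ha, ?_⟩
      simp
      field_simp
      linear_combination h
  have hli' : LinearIndependent F ![a, μ * b - a] := by
    refine LinearIndependent.pair_iff.2 fun s t hst => ?_
    have := LinearIndependent.pair_iff.1 hli (s - t) (t * m) (by
      rw [← hst]; simp only [Algebra.smul_def, map_sub, map_mul, ← hμ]; ring)
    have ht : t = 0 := (mul_eq_zero.1 this.2).resolve_right hm0
    exact ⟨by simpa [ht] using this.1, ht⟩
  have hspan : span F (Set.range ![a, μ * b - a]) ≤ A ⊓ A.map (LinearMap.mulLeft F (-(a / b))) :=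
    span_le.2 (Set.range_subset_iff.2 hmem)
  have h2 := Submodule.finrank_mono hspan
  rw [finrank_span_eq_card hli'] at h2
  simpa using h2.trans (hA _ hx)

variable [Fintype F]

/-- Power sums over the radical dimensions of the forms `productForm A φ`: the first counts the zeros
of `(a, b) ↦ a b` on `A × A`, the second those of the norm form. -/
theorem IsSidonSpace.sum_pow_finrank_ker (hA : IsSidonSpace A) [Fintype (Dual F ↥(A * A))] :
    ∑ φ, (Fintype.card F : ℤ) ^ (finrank F A + finrank F (LinearMap.ker (productForm A φ))) =
        Fintype.card F ^ finrank F ↥(A * A) * (2 * Fintype.card F ^ finrank F A - 1) ∧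
      ∑ φ, (-(Fintype.card F : ℤ)) ^ (finrank F A + finrank F (LinearMap.ker (productForm A φ))) =
        Fintype.card F ^ finrank F ↥(A * A) := by
  classical
  have : FiniteDimensional F ↥(A * A) := Module.Finite.iff_fg.2
    ((Module.Finite.iff_fg.1 ‹_›).mul (Module.Finite.iff_fg.1 ‹_›))
  have : Finite A := Module.finite_of_finite F
  have : Fintype A := Fintype.ofFinite A
  obtain ⟨m, hm⟩ := exists_forall_sq_ne_add F
  have hχ : AddChar.FiniteField.primitiveChar_to_Complex F ≠ 1 := by
    simpa using AddChar.FiniteField.primitiveChar_to_Complex_isPrimitive F one_ne_zero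
  constructor
  · refine (Int.cast_injective (α := ℂ)) ?_
    push_cast
    simp_rw [← sum_bilin hχ, productForm_apply]
    rw [Finset.sum_comm, Finset.sum_congr rfl fun a _ => Finset.sum_comm]
    simp_rw [sum_dual hχ]
    have hzero (a b : A) : (⟨a * b, Submodule.mul_mem_mul a.2 b.2⟩ : ↥(A * A)) = 0 ↔
        a = 0 ∨ b = 0 := by
      rw [Subtype.ext_iff]
      simp
    simp_rw [hzero]
    rw [← Finset.add_sum_erase _ _ (Finset.mem_univ (0 : A)),
      Finset.sum_congr (s₁ := Finset.univ.erase (0 : A)) rfl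
        (g := fun _ => (Fintype.card F : ℂ) ^ finrank F ↥(A * A))
        fun a ha => by simp [Finset.ne_of_mem_erase ha]]
    have hcard := Module.card_eq_pow_finrank (K := F) (V := A)
    rw [Finset.sum_const, Finset.card_erase_of_mem (Finset.mem_univ _), Finset.card_univ,
      nsmul_eq_mul, Nat.cast_sub Fintype.card_pos]
    simp [hcard]
    ring
  · refine (Int.cast_injective (α := ℂ)) ?_
    push_cast
    simp_rw [← sum_hermForm hχ hm (productForm_comm A _)]
    rw [Finset.sum_comm]
    have hform (φ : Dual F ↥(A * A)) (u : A × A) : hermForm m (productForm A φ) u =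
        φ (⟨u.1 * u.1, Submodule.mul_mem_mul u.1.2 u.1.2⟩ +
          ⟨u.1 * u.2, Submodule.mul_mem_mul u.1.2 u.2.2⟩ -
          m • ⟨u.2 * u.2, Submodule.mul_mem_mul u.2.2 u.2.2⟩) := by
      simp only [hermForm, productForm_apply, map_add, map_sub, map_smul, smul_eq_mul]
    simp_rw [hform, sum_dual hχ]
    rw [Finset.sum_eq_single 0]
    · rw [if_pos]
      simp
    · intro u _ hu
      refine if_neg fun h => hu ?_
      obtain ⟨h1, h2⟩ := hA.eq_zero_of_norm_eq_zero hm u.1.2 u.2.2 (Subtype.ext_iff.1 h)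
      exact Prod.ext (Subtype.ext h1) (Subtype.ext h2)
    · simp

theorem IsSidonSpace.two_mul_finrank_le_finrank_mul_self (hA : IsSidonSpace A)
    (h3 : 3 ≤ finrank F A) : 2 * finrank F A ≤ finrank F ↥(A * A) := by
  classical
  by_contra! hlt
  have : FiniteDimensional F ↥(A * A) := Module.Finite.iff_fg.2
    ((Module.Finite.iff_fg.1 ‹_›).mul (Module.Finite.iff_fg.1 ‹_›))
  have : Finite (Dual F ↥(A * A)) := Module.finite_of_finite F
  have : Fintype (Dual F ↥(A * A)) := Fintype.ofFinite _
  have hdim : finrank F ↥(A * A) + 1 = 2 * finrank F A := by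
    have : Nontrivial A := Module.nontrivial_of_finrank_pos (R := F) (by omega)
    obtain ⟨x, hx⟩ := exists_ne (0 : A)
    obtain ⟨y, hxy⟩ := exists_linearIndependent_pair_of_one_lt_finrank (R := F) (by omega) hx
    have hli : LinearIndependent F ![(x : L), (y : L)] := by
      have := hxy.map' A.subtype A.ker_subtype
      rwa [show A.subtype ∘ ![x, y] = ![(x : L), (y : L)] by ext i; fin_cases i <;> rfl] at this
    have h1 := hA.two_mul_finrank_le hli
    have h2 := Submodule.finrank_mono (map_mulLeft_sup_le x.2 y.2)
    omega
  let d (φ : Dual F ↥(A * A)) : ℕ := finrank F (LinearMap.ker (productForm A φ))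
  have hd0 : d 0 = finrank F A := by
    have : productForm A 0 = 0 := by ext; simp [productForm_apply]
    change finrank F (LinearMap.ker (productForm A 0)) = _
    rw [this, LinearMap.ker_zero, finrank_top]
  have hsplit (f : ℕ → ℤ) : ∑ φ, f (d φ) = f (finrank F A) +
      (Finset.univ.filter fun φ => φ ≠ 0 ∧ d φ = 0).card * f 0 +
      (Finset.univ.filter fun φ => φ ≠ 0 ∧ d φ ≠ 0).card * f 1 := by
    have hne : ∑ φ ∈ Finset.univ.filter fun φ => φ ≠ 0 ∧ d φ ≠ 0, f (d φ) =
        ∑ φ ∈ Finset.univ.filter fun φ => φ ≠ 0 ∧ d φ ≠ 0, f 1 := by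
      refine Finset.sum_congr rfl fun φ hφ => ?_
      obtain ⟨hφ0, hdφ⟩ := (Finset.mem_filter.1 hφ).2
      have : d φ ≤ 1 := hA.finrank_ker_productForm_le hdim.le hφ0
      rw [show d φ = 1 by omega]
    have heq : ∑ φ ∈ Finset.univ.filter fun φ => φ ≠ 0 ∧ d φ = 0, f (d φ) =
        ∑ φ ∈ Finset.univ.filter fun φ => φ ≠ 0 ∧ d φ = 0, f 0 :=
      Finset.sum_congr rfl fun φ hφ => by rw [(Finset.mem_filter.1 hφ).2.2]
    rw [← Finset.add_sum_erase _ _ (Finset.mem_univ 0), hd0, ← Finset.filter_ne',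
      ← Finset.sum_filter_add_sum_filter_not _ (fun φ => d φ = 0), Finset.filter_filter,
      Finset.filter_filter, hne, heq]
    simp [add_assoc]
  generalize (Finset.univ.filter fun φ => φ ≠ 0 ∧ d φ = 0).card = E at hsplit
  generalize (Finset.univ.filter fun φ => φ ≠ 0 ∧ d φ ≠ 0).card = D at hsplit
  obtain ⟨hsum, hsum_neg⟩ := hA.sum_pow_finrank_ker
  have hcount := hsplit fun _ => 1
  have hcard := Module.card_eq_pow_finrank (K := F) (V := Dual F ↥(A * A))
  rw [Subspace.dual_finrank_eq] at hcard
  simp only [Finset.sum_const, Finset.card_univ, hcard, nsmul_eq_mul, mul_one] at hcount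
  push_cast at hcount
  rw [hsplit fun i => (Fintype.card F : ℤ) ^ (finrank F A + i)] at hsum
  rw [hsplit fun i => (-(Fintype.card F : ℤ)) ^ (finrank F A + i)] at hsum_neg
  have hq : (2 : ℤ) ≤ Fintype.card F := by exact_mod_cast Fintype.one_lt_card (α := F)
  exact absurd hsum_neg (ne_of_counting_identities hq h3 hdim hcount hsum)

end Sidon

theorem stmt15 {F L : Type*} [Field F] [Fintype F] [Field L] [Algebra F L]
    (A : Submodule F L) (hfd : FiniteDimensional F ↥A)
    (hSidon : ∀ x : L, x ∉ Set.range (algebraMap F L) →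
      finrank F ↥(A ⊓ A.map (LinearMap.mulLeft F x)) ≤ 1)
    (h3 : 3 ≤ finrank F ↥A) :
    2 * (finrank F ↥A : ℤ) - 1 < (finrank F ↥(A * A) : ℤ) := by
  have := IsSidonSpace.two_mul_finrank_le_finrank_mul_self hSidon h3
  omega
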